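/- For all positive integers n and m with 1 ≤ m ≤ ⌊n/2⌋, we have h(n,m) ≥ h(n, n−m). -/

import Mathlib

/-- The generalized binomial coefficient `C(a,k) = a(a-1)⋯(a-k+1)/k!` for an integer `a`
and natural number `k`, as a rational number. -/
def genChoose (a : ℤ) (k : ℕ) : ℚ :=
  (∏ i ∈ Finset.range k, ((a : ℚ) - i)) / (Nat.factorial k)

/-- `hNM n m` is the maximum of the set of `q ∈ ℕ` with `q ≤ n + m` such that
`C(q-n, 2ℓ) + C(q-m, 2ℓ) ≥ C(q, 2ℓ)` for all integers `ℓ` with `1 ≤ ℓ ≤ ⌊q/2⌋`.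
For `n ≥ m ≥ 1` it equals the Hilbert depth of `S_{n,m}/I_{n,m}`. -/
noncomputable def hNM (n m : ℕ) : ℕ :=
  sSup {q : ℕ | q ≤ n + m ∧ ∀ ℓ : ℕ, 1 ≤ ℓ → ℓ ≤ q / 2 →
    genChoose (q : ℤ) (2 * ℓ) ≤
      genChoose ((q : ℤ) - n) (2 * ℓ) + genChoose ((q : ℤ) - m) (2 * ℓ)}

theorem genChoose_natCast (N k : ℕ) : genChoose (N : ℤ) k = N.choose k := by
  have h : ∏ i ∈ Finset.range k, (((N : ℤ) : ℚ) - i) = (N.descFactorial k : ℚ) := by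
    rw [← descPochhammer_eval_eq_descFactorial, descPochhammer_eval_eq_prod_range]
    simp
  rw [genChoose, h, Nat.descFactorial_eq_factorial_mul_choose, Nat.cast_mul]
  have : (k.factorial : ℚ) ≠ 0 := by exact_mod_cast k.factorial_ne_zero
  field_simp

theorem genChoose_reflect (a : ℤ) (l : ℕ) :
    genChoose (2 * l - 1 - a) (2 * l) = genChoose a (2 * l) := by
  unfold genChoose
  congr 1
  rw [← Finset.prod_range_reflect]
  calc _ = ∏ i ∈ Finset.range (2 * l), (-1 : ℚ) * ((a : ℚ) - i) := by
        refine Finset.prod_congr rfl fun i hi => ?_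
        have hi' := Finset.mem_range.mp hi
        have h : i ≤ 2 * l - 1 := by omega
        rw [Nat.cast_sub h, Nat.cast_sub (by omega : 1 ≤ 2 * l)]
        push_cast
        ring
    _ = _ := by
        rw [Finset.prod_mul_distrib]
        simp

theorem genChoose_mono {a b : ℤ} (ha : 0 ≤ a) (hab : a ≤ b) (k : ℕ) :
    genChoose a k ≤ genChoose b k := by
  lift a to ℕ using ha
  lift b to ℕ using by omega
  rw [genChoose_natCast, genChoose_natCast]
  exact_mod_cast Nat.choose_le_choose k (by omega)

theorem genChoose_even_nonneg (a : ℤ) (l : ℕ) : 0 ≤ genChoose a (2 * l) := by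
  have key (b : ℤ) (hb : 0 ≤ b) : 0 ≤ genChoose b (2 * l) := by
    lift b to ℕ using hb
    rw [genChoose_natCast]
    positivity
  rcases le_or_gt 0 a with ha | ha
  · exact key a ha
  · rw [← genChoose_reflect]
    exact key _ (by omega)

theorem genChoose_two (a : ℤ) : genChoose a 2 = a * (a - 1) / 2 := by
  simp [genChoose, Finset.prod_range_succ]

/-- For 1 ≤ m ≤ ⌊n/2⌋, we have h(n,m) ≥ h(n, n−m). -/
theorem hNM_ge_complement (n m : ℕ) (hm : 1 ≤ m) (hm' : m ≤ n / 2) :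
    hNM n (n - m) ≤ hNM n m := by
  refine csSup_le_csSup ⟨n + m, fun q hq => hq.1⟩
    ⟨0, Nat.zero_le _, fun l h₁ h₂ => by omega⟩ ?_
  rintro q ⟨hq, h⟩
  rw [Nat.cast_sub (by omega : m ≤ n)] at h
  refine ⟨?_, fun l h₁ h₂ => ?_⟩
  · by_contra! hlt
    have h2 := h 1 le_rfl (by omega)
    simp only [mul_one, genChoose_two] at h2
    push_cast at h2
    have hx : (1 : ℚ) ≤ q - n := by
      have : (n : ℚ) + 1 ≤ q := by exact_mod_cast (by omega : n + 1 ≤ q)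
      linarith
    have hm1 : (1 : ℚ) ≤ m := by exact_mod_cast hm
    have hz : (q : ℚ) ≤ 2 * n - m := by
      have : (q : ℚ) + m ≤ 2 * n := by exact_mod_cast (by omega : q + m ≤ 2 * n)
      linarith
    have hxy : 0 < ((q : ℚ) - n) * (q - n + m) := by
      apply mul_pos <;> linarith
    have hq0 : (0 : ℚ) ≤ 2 * n - m - q := by linarith
    have hs : (0 : ℚ) ≤ q + (2 * q - 2 * n + m) - 1 := by linarith
    nlinarith [mul_nonneg hq0 hs]
  · rcases le_total (2 * (q : ℤ) - n + 1) (2 * l) with hl | hl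
    · have h3 := genChoose_mono (by omega) (by omega : (q : ℤ) ≤ 2 * l - 1 - (q - n)) (2 * l)
      rw [genChoose_reflect] at h3
      linarith [genChoose_even_nonneg ((q : ℤ) - m) l]
    · refine (h l h₁ h₂).trans ?_
      gcongr 1
      rcases le_or_gt 0 ((q : ℤ) - (n - m)) with h0 | h0
      · exact genChoose_mono h0 (by omega) _
      · rw [← genChoose_reflect]
        exact genChoose_mono (by omega) (by omega) _
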